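/- Let π ∈ S, let τ^π = τ_{F^π}, let s ≥ 1, and let 𝐧 = 2^{2m_s}𝟏 + 2^{m_s}𝐩 + 𝐪 with 𝐩, 𝐪 ∈ {0,…,2^{m_s}−1}^d. Then for every 𝐦 ∈ {0,…,2^{m_s}−1}^d the local coefficient satisfies (τ^π)̂_𝐧(Δ^{(m_s)}_𝐦) = 2^{s−1−d·m_s} · W^{(m_s)}_{𝐪𝐦} if π_s(𝐦) = 𝐩 and Δ^{(m_s)}_𝐦 ⊆ F̃^π_{s−1}, and (τ^π)̂_𝐧(Δ^{(m_s)}_𝐦) = 0 otherwise. Consequently, (τ^π)̂_𝐧 = 2^{s−1−d·m_s} · W^{(m_s)}_{𝐪,π_s^{−1}(𝐩)} if Δ^{(m_s)}_{π_s^{−1}(𝐩)} ⊆ F̃^π_{s−1}, and (τ^π)̂_𝐧 = 0 otherwise. -/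

import Mathlib

open Filter Finset Topology MeasureTheory
open scoped Classical

noncomputable section

instance : TopologicalSpace (ZMod 2) := ⊥
instance : DiscreteTopology (ZMod 2) := ⟨rfl⟩

/-- The dyadic (Cantor) group `𝔾`: sequences of elements of `ℤ/2ℤ`
with coordinatewise addition modulo 2, Tychonoff topology. -/
abbrev DyadicGroup : Type := ℕ → ZMod 2

instance : MeasurableSpace DyadicGroup := borel _
instance : BorelSpace DyadicGroup := ⟨rfl⟩

/-- `𝔾^d`. -/
abbrev GD (d : ℕ) : Type := Fin d → DyadicGroup

/-- One-dimensional Walsh function `W_n` in the Paley enumeration: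
`W_n(g) = ∏_k (-1)^(g_k n_k)`. -/
def walsh (n : ℕ) (g : DyadicGroup) : ℝ :=
  ∏ k ∈ Finset.range n, if n.testBit k ∧ g k = 1 then (-1 : ℝ) else 1

/-- `d`-dimensional Walsh function `W_𝐧(𝐠) = ∏ W_{n^l}(g^l)`. -/
def walshD {d : ℕ} (n : Fin d → ℕ) (g : GD d) : ℝ :=
  ∏ l, walsh (n l) (g l)

/-- The dyadic interval `Δ^{(k)}_m` of rank `k`. -/
def dyadicInterval (k m : ℕ) : Set DyadicGroup :=
  {g | ∀ t < k, g t = if m.testBit (k - 1 - t) then 1 else 0}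

/-- The dyadic cube `Δ^{(k)}_𝐦 = Δ^{(k)}_{m^1} × ⋯ × Δ^{(k)}_{m^d}`. -/
def dyadicCube {d : ℕ} (k : ℕ) (m : Fin d → ℕ) : Set (GD d) :=
  {g | ∀ l, g l ∈ dyadicInterval k (m l)}

/-- The canonical point of `Δ^{(k)}_m`. -/
def intervalPoint (k m : ℕ) : DyadicGroup :=
  fun t => if t < k ∧ m.testBit (k - 1 - t) then 1 else 0

/-- The canonical point of `Δ^{(k)}_𝐦`. -/
def cubePoint {d : ℕ} (k : ℕ) (m : Fin d → ℕ) : GD d :=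
  fun l => intervalPoint k (m l)

/-- `W^{(k)}_{n,m}`: the (constant, for `n < 2^k`) value of `W_n` on `Δ^{(k)}_m`. -/
def walshVal (k n m : ℕ) : ℝ := walsh n (intervalPoint k m)

/-- `W^{(k)}_{𝐧𝐦}`: the (constant, for `𝐧 < 2^k·𝟏`) value of `W_𝐧` on `Δ^{(k)}_𝐦`. -/
def walshValD {d : ℕ} (k : ℕ) (n m : Fin d → ℕ) : ℝ := walshD n (cubePoint k m)

/-- The box `{𝐧 : 𝐧 < 𝐍}` as a finset. -/
def boxLt {d : ℕ} (N : Fin d → ℕ) : Finset (Fin d → ℕ) :=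
  Fintype.piFinset fun l => Finset.range (N l)

/-- The box `{0,…,2^k−1}^d` as a set. -/
def box (d k : ℕ) : Set (Fin d → ℕ) := {m | ∀ l, m l < 2 ^ k}

/-- The rectangular partial sum `S_𝐍(𝐠)` of the Walsh series with coefficients `a`. -/
def walshPartialSum {d : ℕ} (a : (Fin d → ℕ) → ℂ) (N : Fin d → ℕ) (g : GD d) : ℂ :=
  ∑ n ∈ boxLt N, a n * (walshD n g : ℂ)

/-- Convergence over rectangles: `S_𝐍(𝐠) → S` as `min_j N^j → ∞`. -/
def ConvergesOverRectangles {d : ℕ} (a : (Fin d → ℕ) → ℂ) (g : GD d) (S : ℂ) : Prop :=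
  Tendsto (fun N : Fin d → ℕ => walshPartialSum a N g) atTop (𝓝 S)

/-- Convergence over cubes: `S_{N𝟏}(𝐠) → S` as `N → ∞`. -/
def ConvergesOverCubes {d : ℕ} (a : (Fin d → ℕ) → ℂ) (g : GD d) (S : ℂ) : Prop :=
  Tendsto (fun N : ℕ => walshPartialSum a (fun _ => N) g) atTop (𝓝 S)

/-- `λ`-convergence: `S_𝐍(𝐠) → S` as `min_j N^j → ∞` along `𝐍` with `max N^j/N^k ≤ λ`. -/
def LambdaConverges {d : ℕ} (lam : ℝ) (a : (Fin d → ℕ) → ℂ) (g : GD d) (S : ℂ) : Prop :=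
  ∀ ε : ℝ, 0 < ε → ∃ K : ℕ, ∀ N : Fin d → ℕ, (∀ j, K ≤ N j) →
    (∀ j k, (N j : ℝ) ≤ lam * N k) → ‖walshPartialSum a N g - S‖ < ε

/-- Auxiliary predicate for iterated summation of a multiple series with terms `f`;
the list gives the order of summation, *innermost index first*.  After summing the
series in the variables of the list, the remaining (partially summed) function is `g`. -/
def IterConvAux {d : ℕ} : List (Fin d) → ((Fin d → ℕ) → ℂ) → ((Fin d → ℕ) → ℂ) → Prop
  | [], f, g => f = g
  | j :: rest, f, g => ∃ h : (Fin d → ℕ) → ℂ,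
      (∀ n, Tendsto (fun T : ℕ => ∑ t ∈ Finset.range T, f (Function.update n j t))
        atTop (𝓝 (h n))) ∧ IterConvAux rest h g

/-- The multiple series with terms `f` converges iteratedly to `S`, the order of
summation being given by the list `l` (innermost index first): all successively
nested inner series converge and the full iterated sum equals `S`. -/
def IterConverges {d : ℕ} (l : List (Fin d)) (f : (Fin d → ℕ) → ℂ) (S : ℂ) : Prop :=
  ∃ g, IterConvAux l f g ∧ ∀ n, g n = S

/-- `A` is an M-set for the `d`-dimensional Walsh system under rectangular convergence. -/
def IsMSetRect {d : ℕ} (A : Set (GD d)) : Prop :=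
  ∃ a : (Fin d → ℕ) → ℂ, (∃ n, a n ≠ 0) ∧ ∀ g ∉ A, ConvergesOverRectangles a g 0

/-- `A` is an M-set for the `d`-dimensional Walsh system under convergence over cubes. -/
def IsMSetCubes {d : ℕ} (A : Set (GD d)) : Prop :=
  ∃ a : (Fin d → ℕ) → ℂ, (∃ n, a n ≠ 0) ∧ ∀ g ∉ A, ConvergesOverCubes a g 0

/-- `A` is an M-set under iterated convergence with summation order `l` (innermost first). -/
def IsMSetIter {d : ℕ} (A : Set (GD d)) (l : List (Fin d)) : Prop :=
  ∃ a : (Fin d → ℕ) → ℂ, (∃ n, a n ≠ 0) ∧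
    ∀ g ∉ A, IterConverges l (fun n => a n * (walshD n g : ℂ)) 0

/-- `A` is an M-set for the `d`-dimensional Walsh system under `λ`-convergence. -/
def IsMSetLambda {d : ℕ} (lam : ℝ) (A : Set (GD d)) : Prop :=
  ∃ a : (Fin d → ℕ) → ℂ, (∃ n, a n ≠ 0) ∧ ∀ g ∉ A, LambdaConverges lam a g 0

/-- A quasimeasure: a finitely additive function on dyadic cubes (indexed by rank
`k` and position `𝐦 < 2^k·𝟏`). -/
def IsQuasimeasure {d : ℕ} (τ : ℕ → (Fin d → ℕ) → ℂ) : Prop :=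
  ∀ k m, (∀ l, m l < 2 ^ k) →
    τ k m = ∑ σ : Fin d → Fin 2, τ (k + 1) fun l => 2 * m l + (σ l : ℕ)

/-- The quasimeasure generated by the Walsh series with coefficients `a`:
`τ(Δ^{(k)}_𝐦) = 2^{-kd} ∑_{𝐧<2^k𝟏} a_𝐧 W_𝐧(Δ^{(k)}_𝐦)`. -/
def genQM {d : ℕ} (a : (Fin d → ℕ) → ℂ) (k : ℕ) (m : Fin d → ℕ) : ℂ :=
  ((2 : ℂ) ^ (k * d))⁻¹ * ∑ n ∈ boxLt (fun _ : Fin d => 2 ^ k), a n * (walshValD k n m : ℂ)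

/-- The Fourier–Walsh coefficient `τ̂_𝐧` of a quasimeasure `τ`, computed at resolution `k`
(the value does not depend on `k` as long as `𝐧 < 2^k𝟏`). -/
def fourierCoeffAt {d : ℕ} (τ : ℕ → (Fin d → ℕ) → ℂ) (n : Fin d → ℕ) (k : ℕ) : ℂ :=
  ∑ m ∈ boxLt (fun _ : Fin d => 2 ^ k), (walshValD k n m : ℂ) * τ k m

/-- The local Fourier–Walsh coefficient `τ̂_𝐧(Δ^{(r)}_{𝐦Δ})`, computed at resolution `k ≥ r`. -/
def localCoeffAt {d : ℕ} (τ : ℕ → (Fin d → ℕ) → ℂ) (n : Fin d → ℕ)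
    (r : ℕ) (mΔ : Fin d → ℕ) (k : ℕ) : ℂ :=
  ∑ m ∈ (boxLt (fun _ : Fin d => 2 ^ k)).filter
      (fun m => dyadicCube k m ⊆ dyadicCube r mΔ),
    (walshValD k n m : ℂ) * τ k m

/-- The support of a quasimeasure: the complement of the union of all dyadic cubes `Δ₀`
such that `τ(Δ) = 0` for every dyadic cube `Δ ⊆ Δ₀`. -/
def qmSupport {d : ℕ} (τ : ℕ → (Fin d → ℕ) → ℂ) : Set (GD d) :=
  (⋃ k, ⋃ m ∈ box d k,
    ⋃ (_ : ∀ k' m', (∀ l, m' l < 2 ^ k') →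
        dyadicCube k' m' ⊆ dyadicCube k m → τ k' m' = 0),
    dyadicCube k m)ᶜ

/-- The restriction `τ|_{Δ̃}` of a quasimeasure to the dyadic cube `Δ̃ = Δ^{(r)}_{𝐦Δ}`:
`τ|_{Δ̃}(Δ) = τ(Δ̃ ∩ Δ)` (two dyadic cubes are nested or disjoint). -/
def restrictQM {d : ℕ} (τ : ℕ → (Fin d → ℕ) → ℂ) (r : ℕ) (mΔ : Fin d → ℕ) :
    ℕ → (Fin d → ℕ) → ℂ := fun k m =>
  if dyadicCube k m ⊆ dyadicCube (d := d) r mΔ then τ k m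
  else if dyadicCube (d := d) r mΔ ⊆ dyadicCube k m then τ r mΔ
  else 0

/-- `τ` is the canonical quasimeasure `τ_E` associated with a (nonempty closed) set `E`:
`τ(𝔾^d) = 1`; `τ(Δ) = 0` iff `Δ ∩ E = ∅`; and the mass of a cube meeting `E` is divided
equally among its `2^d` immediate subcubes that meet `E`. -/
def IsTauOf {d : ℕ} (E : Set (GD d)) (τ : ℕ → (Fin d → ℕ) → ℂ) : Prop :=
  IsQuasimeasure τ ∧
  τ 0 (fun _ => 0) = 1 ∧
  (∀ k m, (∀ l, m l < 2 ^ k) → (τ k m = 0 ↔ dyadicCube k m ∩ E = ∅)) ∧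
  (∀ k m, (∀ l, m l < 2 ^ k) → (dyadicCube k m ∩ E).Nonempty →
    ∀ σ : Fin d → Fin 2,
      τ (k + 1) (fun l => 2 * m l + (σ l : ℕ)) =
        if (dyadicCube (k + 1) (fun l => 2 * m l + (σ l : ℕ)) ∩ E).Nonempty then
          τ k m / ((Finset.univ.filter fun σ' : Fin d → Fin 2 =>
              (dyadicCube (k + 1) (fun l => 2 * m l + (σ' l : ℕ)) ∩ E).Nonempty).card : ℂ)
        else 0)

/-- The sequence `m_s`: `m_1 = 0`, `m_{s+1} = 2(2m_s+1)` (value at `0` is junk). -/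
def mSeq : ℕ → ℕ
  | 0 => 0
  | s + 1 => if s = 0 then 0 else 2 * (2 * mSeq s + 1)

/-- The layer `F_s^π`. -/
def Fspi {d : ℕ} (π : ℕ → (Fin d → ℕ) → Fin d → ℕ) (s : ℕ) : Set (GD d) :=
  ⋃ m ∈ box d (mSeq s), ⋃ m' ∈ box d (mSeq s),
    {g | g ∈ dyadicCube (2 * mSeq s) (fun l => 2 ^ mSeq s * m l + m' l) ∧
      walshD (fun _ => 2 ^ (2 * mSeq s)) g = walshValD (mSeq s) (π s m) m'}

/-- `F̃_s^π = F_1^π ∩ ⋯ ∩ F_s^π` (so `F̃_0^π = 𝔾^d`). -/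
def Ftil {d : ℕ} (π : ℕ → (Fin d → ℕ) → Fin d → ℕ) (s : ℕ) : Set (GD d) :=
  ⋂ k ∈ Finset.Icc 1 s, Fspi π k

/-- `F^π = ⋂_{s≥1} F_s^π`. -/
def Fpi {d : ℕ} (π : ℕ → (Fin d → ℕ) → Fin d → ℕ) : Set (GD d) :=
  ⋂ s ∈ Set.Ici 1, Fspi π s

/-- The identity element of `S` (yielding `F_s`, `F̃_s` and `F` themselves). -/
def idPerm (d : ℕ) : ℕ → (Fin d → ℕ) → Fin d → ℕ := fun _ m => m

/-- `S`: sequences `π = (π_s)` of permutations of the boxes `{0,…,2^{m_s}−1}^d`. -/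
structure PermSeq (d : ℕ) where
  p : ℕ → Equiv.Perm (Fin d → ℕ)
  maps : ∀ s, Set.MapsTo (p s) (box d (mSeq s)) (box d (mSeq s))

/-- The underlying sequence of functions of an element of `S`. -/
def PermSeq.f {d : ℕ} (π : PermSeq d) : ℕ → (Fin d → ℕ) → Fin d → ℕ := fun s => ⇑(π.p s)

/-- `π ∈ S'`: every `π_s` acts coordinatewise, `π_s(𝐦) = (π_s^1(m^1),…,π_s^d(m^d))`. -/
def PermSeq.Coordinatewise {d : ℕ} (π : PermSeq d) : Prop :=
  ∀ s, ∃ e : Fin d → ℕ → ℕ, ∀ m : Fin d → ℕ, π.p s m = fun l => e l (m l)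

/-- The Dirichlet kernel `D_N = ∑_{n<N} W_n` of the one-dimensional Walsh system. -/
def dirichlet (N : ℕ) (g : DyadicGroup) : ℝ :=
  ∑ n ∈ Finset.range N, walsh n g

/-! ### One-dimensional facts -/

def shiftG (a : ℕ) (g : DyadicGroup) : DyadicGroup := fun t => g (a + t)

def idxG (g : DyadicGroup) : ℕ → ℕ
  | 0 => 0
  | k + 1 => 2 * idxG g k + (g k).val

lemma idxG_lt (g : DyadicGroup) (k : ℕ) : idxG g k < 2 ^ k := by
  induction k with
  | zero => simp [idxG]
  | succ k ih =>
    have : (g k).val < 2 := ZMod.val_lt _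
    simp only [idxG, pow_succ]; omega

lemma zmod2_cases (x : ZMod 2) : x = 0 ∨ x = 1 := by
  revert x; decide

lemma zmod2_val_one : (1 : ZMod 2).val = 1 := rfl

lemma mem_interval_succ (g : DyadicGroup) (k m : ℕ) :
    g ∈ dyadicInterval (k + 1) m ↔
      g ∈ dyadicInterval k (m / 2) ∧ g k = if m.testBit 0 then 1 else 0 := by
  simp only [dyadicInterval, Set.mem_ofPred_eq]
  constructor
  · intro h
    refine ⟨fun t ht => ?_, ?_⟩
    · rw [h t (by omega), Nat.testBit_div_two]
      congr 3; omega
    · rw [h k (by omega)]; simp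
  · rintro ⟨h1, h2⟩ t ht
    rcases Nat.lt_succ_iff_lt_or_eq.mp ht with h | h
    · rw [h1 t h, Nat.testBit_div_two]
      congr 3; omega
    · subst h; rw [h2]; simp

lemma mem_interval_iff (g : DyadicGroup) (k m : ℕ) (hm : m < 2 ^ k) :
    g ∈ dyadicInterval k m ↔ m = idxG g k := by
  induction k generalizing m with
  | zero =>
    have : m = 0 := by simpa using hm
    subst this
    simp [dyadicInterval, idxG]
  | succ k ih =>
    rw [mem_interval_succ, ih (m / 2) (by rw [pow_succ] at hm; omega)]
    simp only [idxG, Nat.testBit_zero]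
    rcases zmod2_cases (g k) with h | h <;> rcases Nat.mod_two_eq_zero_or_one m with h' | h' <;>
      simp [h, h', zmod2_val_one] <;> omega

lemma mem_idx (g : DyadicGroup) (k : ℕ) : g ∈ dyadicInterval k (idxG g k) :=
  (mem_interval_iff g k _ (idxG_lt g k)).2 rfl

lemma intervalPoint_mem (k m : ℕ) : intervalPoint k m ∈ dyadicInterval k m := by
  intro t ht
  simp [intervalPoint, ht]

lemma idxG_point (k m : ℕ) (hm : m < 2 ^ k) : idxG (intervalPoint k m) k = m :=
  ((mem_interval_iff _ k m hm).1 (intervalPoint_mem k m)).symm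

lemma idxG_congr {g h : DyadicGroup} {k : ℕ} (H : ∀ t < k, g t = h t) : idxG g k = idxG h k := by
  induction k with
  | zero => rfl
  | succ k ih => simp only [idxG]; rw [ih fun t ht => H t (by omega), H k (by omega)]

lemma agree_of_idxG {g h : DyadicGroup} {k : ℕ} (H : idxG g k = idxG h k) : ∀ t < k, g t = h t := by
  intro t ht
  have h1 := mem_idx g k t ht
  have h2 := mem_idx h k t ht
  rw [h1, h2, H]

lemma idxG_add (g : DyadicGroup) (a b : ℕ) :
    idxG g (a + b) = 2 ^ b * idxG g a + idxG (shiftG a g) b := by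
  induction b with
  | zero => simp [idxG]
  | succ b ih =>
    rw [← add_assoc]
    simp only [idxG, ih, shiftG, pow_succ]; ring

/-- a walsh factor -/
def wfac (b : Bool) (x : ZMod 2) : ℝ := if b ∧ x = 1 then (-1 : ℝ) else 1

lemma wfac_false (x : ZMod 2) : wfac false x = 1 := by simp [wfac]

lemma wfac_sq (b : Bool) (x : ZMod 2) : wfac b x * wfac b x = 1 := by
  unfold wfac; split_ifs <;> norm_num

lemma walsh_eq (n K : ℕ) (hn : n < 2 ^ K) (g : DyadicGroup) :
    walsh n g = ∏ k ∈ Finset.range K, wfac (n.testBit k) (g k) := by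
  have key : ∀ N, n < 2 ^ N → ∏ k ∈ Finset.range N, wfac (n.testBit k) (g k)
      = ∏ k ∈ Finset.range (N + K + n), wfac (n.testBit k) (g k) := by
    intro N hN
    apply Finset.prod_subset
    · intro x; simp; omega
    · intro x _ hx
      rw [Nat.testBit_eq_false_of_lt, wfac_false]
      refine lt_of_lt_of_le hN (Nat.pow_le_pow_right (by norm_num) ?_)
      simpa using hx
  have h1 := key n Nat.lt_two_pow_self
  have h2 := key K hn
  have : walsh n g = ∏ k ∈ Finset.range n, wfac (n.testBit k) (g k) := by
    simp [walsh, wfac]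
  rw [this, h1, h2]
  have h3 : ∏ k ∈ Finset.range (n + K + n), wfac (n.testBit k) (g k) =
      ∏ k ∈ Finset.range (K + n), wfac (n.testBit k) (g k) := by
    symm
    apply Finset.prod_subset
    · intro x; simp; omega
    · intro x _ hx
      rw [Nat.testBit_eq_false_of_lt, wfac_false]
      refine lt_of_lt_of_le hn (Nat.pow_le_pow_right (by norm_num) ?_)
      simp at hx; omega
  have h4 : ∏ k ∈ Finset.range (K + K + n), wfac (n.testBit k) (g k) =
      ∏ k ∈ Finset.range (K + n), wfac (n.testBit k) (g k) := by
    symm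
    apply Finset.prod_subset
    · intro x; simp; omega
    · intro x _ hx
      rw [Nat.testBit_eq_false_of_lt, wfac_false]
      refine lt_of_lt_of_le hn (Nat.pow_le_pow_right (by norm_num) ?_)
      simp at hx; omega
  rw [h3, h4]

lemma walsh_congr {n K : ℕ} (hn : n < 2 ^ K) {g h : DyadicGroup} (H : ∀ t < K, g t = h t) :
    walsh n g = walsh n h := by
  rw [walsh_eq n K hn, walsh_eq n K hn]
  exact Finset.prod_congr rfl fun t ht => by rw [H t (by simpa using ht)]

lemma walsh_sq (n : ℕ) (g : DyadicGroup) : walsh n g * walsh n g = 1 := by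
  rw [walsh_eq n n Nat.lt_two_pow_self, ← Finset.prod_mul_distrib]
  exact Finset.prod_eq_one fun t _ => wfac_sq _ _

lemma walsh_split (a x q : ℕ) (hq : q < 2 ^ a) (g : DyadicGroup) :
    walsh (2 ^ a * x + q) g = walsh x (shiftG a g) * walsh q g := by
  have hx : x < 2 ^ x := Nat.lt_two_pow_self
  have h : 2 ^ a * x + q < 2 ^ (a + x) := by
    rw [pow_add]; nlinarith
  rw [walsh_eq _ _ h, walsh_eq x x hx, walsh_eq q a hq, Finset.prod_range_add, mul_comm]
  congr 1
  · refine Finset.prod_congr rfl fun t ht => ?_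
    rw [Nat.testBit_two_pow_mul_add _ hq, if_neg (by omega)]
    simp [shiftG]
  · refine Finset.prod_congr rfl fun t ht => ?_
    rw [Nat.testBit_two_pow_mul_add _ hq, if_pos (by simpa using ht)]

lemma walsh_pow (a : ℕ) (g : DyadicGroup) : walsh (2 ^ a) g = wfac true (g a) := by
  have := walsh_split a 1 0 (by positivity) g
  simp only [mul_one, add_zero] at this
  rw [this, walsh_eq 1 1 (by norm_num), walsh_eq 0 0 (by norm_num)]
  simp [shiftG]

lemma walshVal_eq (k n m : ℕ) (hn : n < 2 ^ k) (g : DyadicGroup) (hg : g ∈ dyadicInterval k m) :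
    walshVal k n m = walsh n g := by
  apply walsh_congr hn
  intro t ht
  rw [intervalPoint_mem k m t ht, hg t ht]

lemma walsh_orth (k p p' : ℕ) (hp : p < 2 ^ k) (hp' : p' < 2 ^ k) :
    ∑ m ∈ Finset.range (2 ^ k), walshVal k p m * walshVal k p' m
      = if p = p' then (2 : ℝ) ^ k else 0 := by
  split_ifs with h
  · subst h
    simp [walshVal, walsh_sq]
  · obtain ⟨t, ht⟩ := Nat.exists_testBit_ne_of_ne h
    have htk : t < k := by
      by_contra hk
      have : 2 ^ k ≤ 2 ^ t := Nat.pow_le_pow_right (by norm_num) (by omega)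
      rw [Nat.testBit_eq_false_of_lt (by omega), Nat.testBit_eq_false_of_lt (by omega)] at ht
      exact ht rfl
    have key : ∀ m, walshVal k p (m ^^^ 2 ^ (k - 1 - t)) * walshVal k p' (m ^^^ 2 ^ (k - 1 - t))
        = - (walshVal k p m * walshVal k p' m) := by
      intro m
      simp only [walshVal, walsh_eq p k hp, walsh_eq p' k hp', ← Finset.prod_mul_distrib]
      rw [← Finset.mul_prod_erase _ _ (Finset.mem_range.2 htk),
        ← Finset.mul_prod_erase (Finset.range k) (fun i => wfac (p.testBit i)
          (intervalPoint k m i) * _) (Finset.mem_range.2 htk), ← neg_mul]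
      congr 1
      · simp only [intervalPoint, Nat.testBit_xor, Nat.testBit_two_pow_self, htk, wfac]
        revert ht
        cases p.testBit t <;> cases p'.testBit t <;> cases m.testBit (k - 1 - t) <;> simp
      · refine Finset.prod_congr rfl fun i hi => ?_
        have hi' : i ≠ t ∧ i < k := by simpa using hi
        simp only [intervalPoint, Nat.testBit_xor]
        rw [Nat.testBit_two_pow_of_ne (by omega)]
        simp
    refine Finset.sum_involution (fun m _ => m ^^^ 2 ^ (k - 1 - t)) ?_ ?_ ?_ ?_
    · intro m _; rw [key]; ring
    · intro m _ _ he
      have := congrArg (fun x => Nat.testBit x (k - 1 - t)) he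
      simp [Nat.testBit_xor, Nat.testBit_two_pow_self] at this
    · intro m hm
      simp only [Finset.mem_range] at hm ⊢
      exact Nat.xor_lt_two_pow hm (Nat.pow_lt_pow_right (by norm_num) (by omega))
    · intro m _
      rw [Nat.xor_assoc, Nat.xor_self, Nat.xor_zero]

/-! ### d-dimensional facts -/

def idxD {d : ℕ} (g : GD d) (k : ℕ) : Fin d → ℕ := fun l => idxG (g l) k

def shiftD {d : ℕ} (a : ℕ) (g : GD d) : GD d := fun l => shiftG a (g l)

def AgreeD {d : ℕ} (k : ℕ) (g h : GD d) : Prop := ∀ l, ∀ t < k, g l t = h l t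

lemma AgreeD.symm' {d k : ℕ} {g h : GD d} (H : AgreeD k g h) : AgreeD k h g :=
  fun l t ht => (H l t ht).symm

lemma AgreeD.trans' {d k : ℕ} {g h i : GD d} (H : AgreeD k g h) (H' : AgreeD k h i) :
    AgreeD k g i :=
  fun l t ht => (H l t ht).trans (H' l t ht)

lemma AgreeD.mono' {d k k' : ℕ} {g h : GD d} (H : AgreeD k g h) (hk : k' ≤ k) : AgreeD k' g h :=
  fun l t ht => H l t (by omega)

lemma idxD_congr {d k : ℕ} {g h : GD d} (H : AgreeD k g h) : idxD g k = idxD h k :=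
  funext fun l => idxG_congr (H l)

lemma agree_of_idxD {d k : ℕ} {g h : GD d} (H : idxD g k = idxD h k) : AgreeD k g h :=
  fun l => agree_of_idxG (congrFun H l)

lemma mem_cube_iff {d k : ℕ} {m : Fin d → ℕ} (hm : ∀ l, m l < 2 ^ k) (g : GD d) :
    g ∈ dyadicCube k m ↔ m = idxD g k := by
  constructor
  · intro h; funext l
    exact (mem_interval_iff _ _ _ (hm l)).1 (h l)
  · intro h l
    exact (mem_interval_iff _ _ _ (hm l)).2 (congrFun h l)

lemma idxD_lt {d : ℕ} (g : GD d) (k : ℕ) (l : Fin d) : idxD g k l < 2 ^ k := idxG_lt _ _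

lemma idxD_point {d k : ℕ} {m : Fin d → ℕ} (hm : ∀ l, m l < 2 ^ k) :
    idxD (cubePoint k m) k = m := funext fun l => idxG_point k _ (hm l)

lemma walshD_congr {d K : ℕ} {n : Fin d → ℕ} (hn : ∀ l, n l < 2 ^ K) {g h : GD d}
    (H : AgreeD K g h) : walshD n g = walshD n h :=
  Finset.prod_congr rfl fun l _ => walsh_congr (hn l) (H l)

lemma walshD_sq {d : ℕ} (n : Fin d → ℕ) (g : GD d) : walshD n g * walshD n g = 1 := by
  rw [walshD, ← Finset.prod_mul_distrib]
  exact Finset.prod_eq_one fun l _ => walsh_sq _ _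

lemma walshD_cases {d : ℕ} (n : Fin d → ℕ) (g : GD d) : walshD n g = 1 ∨ walshD n g = -1 :=
  mul_self_eq_one_iff.1 (walshD_sq n g)

lemma walshValD_eq {d : ℕ} (k : ℕ) (n : Fin d → ℕ) (hn : ∀ l, n l < 2 ^ k) (g : GD d) :
    walshValD k n (idxD g k) = walshD n g := by
  apply walshD_congr hn
  exact agree_of_idxD (idxD_point (idxD_lt g k))

lemma walshD_split {d : ℕ} (a : ℕ) (x q : Fin d → ℕ) (hq : ∀ l, q l < 2 ^ a) (g : GD d) :
    walshD (fun l => 2 ^ a * x l + q l) g = walshD x (shiftD a g) * walshD q g := by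
  simp only [walshD, ← Finset.prod_mul_distrib]
  exact Finset.prod_congr rfl fun l _ => walsh_split _ _ _ (hq l) _

lemma walshD_orth {d : ℕ} (k : ℕ) (p p' : Fin d → ℕ) (hp : ∀ l, p l < 2 ^ k)
    (hp' : ∀ l, p' l < 2 ^ k) :
    ∑ m ∈ boxLt (fun _ : Fin d => 2 ^ k), walshValD k p m * walshValD k p' m
      = if p = p' then (2 : ℝ) ^ (d * k) else 0 := by
  have h : ∑ m ∈ boxLt (fun _ : Fin d => 2 ^ k), walshValD k p m * walshValD k p' m
      = ∏ l, ∑ m ∈ Finset.range (2 ^ k), walshVal k (p l) m * walshVal k (p' l) m := by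
    rw [Finset.prod_univ_sum]
    refine Finset.sum_congr rfl fun m _ => ?_
    simp only [walshValD, walshD, ← Finset.prod_mul_distrib]
    rfl
  rw [h, Finset.prod_congr rfl fun l _ => walsh_orth k (p l) (p' l) (hp l) (hp' l)]
  split_ifs with hpp
  · subst hpp
    simp [← pow_mul, mul_comm]
  · obtain ⟨l, hl⟩ := Function.ne_iff.1 hpp
    exact Finset.prod_eq_zero (Finset.mem_univ l) (if_neg hl)

lemma idxD_add {d : ℕ} (g : GD d) (a b : ℕ) :
    idxD g (a + b) = fun l => 2 ^ b * idxD g a l + idxD (shiftD a g) b l :=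
  funext fun l => idxG_add _ _ _

lemma divmod_unique {N a b a' b' : ℕ} (hb : b < N) (hb' : b' < N)
    (h : N * a + b = N * a' + b') : a = a' ∧ b = b' := by
  have h1 : (N * a + b) / N = a := by
    rw [Nat.mul_add_div (by omega), Nat.div_eq_of_lt hb, add_zero]
  have h2 : (N * a' + b') / N = a' := by
    rw [Nat.mul_add_div (by omega), Nat.div_eq_of_lt hb', add_zero]
  have : a = a' := by rw [← h1, h, h2]
  subst this
  exact ⟨rfl, by omega⟩

lemma box_lt_add {d a b : ℕ} {m m' : Fin d → ℕ} (hm : ∀ l, m l < 2 ^ a) (hm' : ∀ l, m' l < 2 ^ b)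
    (l : Fin d) : 2 ^ b * m l + m' l < 2 ^ (a + b) := by
  have h1 := hm l
  have h2 := hm' l
  rw [pow_add]
  nlinarith

lemma Fspi_iff {d : ℕ} (π : PermSeq d) (s : ℕ) (g : GD d) :
    g ∈ Fspi π.f s ↔ walshD (fun _ => 2 ^ (2 * mSeq s)) g =
      walshD (π.p s (idxD g (mSeq s))) (shiftD (mSeq s) g) := by
  have hidx := idxD_add g (mSeq s) (mSeq s)
  rw [← two_mul] at hidx
  have hbox : ∀ l, π.p s (idxD g (mSeq s)) l < 2 ^ mSeq s :=
    π.maps s (show idxD g (mSeq s) ∈ box d (mSeq s) from idxD_lt g _)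
  simp only [Fspi, Set.mem_iUnion, Set.mem_ofPred_eq, PermSeq.f]
  constructor
  · rintro ⟨m, hm, m', hm', hc, hw⟩
    have hlt := fun l => box_lt_add hm hm' l
    rw [← two_mul] at hlt
    rw [mem_cube_iff hlt, hidx] at hc
    have hmm : m = idxD g (mSeq s) ∧ m' = idxD (shiftD (mSeq s) g) (mSeq s) := by
      have := fun l => divmod_unique (hm' l) (idxD_lt (shiftD (mSeq s) g) (mSeq s) l) (congrFun hc l)
      exact ⟨funext fun l => (this l).1, funext fun l => (this l).2⟩
    obtain ⟨rfl, rfl⟩ := hmm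
    rw [hw, walshValD_eq _ _ hbox]
  · intro h
    refine ⟨idxD g (mSeq s), idxD_lt g _, idxD (shiftD (mSeq s) g) (mSeq s), idxD_lt _ _, ?_, ?_⟩
    · rw [← hidx, mem_cube_iff (idxD_lt _ _)]
    · rw [walshValD_eq _ _ hbox, h]

lemma shiftD_agree {d a b : ℕ} {g h : GD d} (H : AgreeD (a + b) g h) :
    AgreeD b (shiftD a g) (shiftD a h) := fun l t ht => H l (a + t) (by omega)

lemma Fspi_congr {d : ℕ} (π : PermSeq d) (s : ℕ) {g h : GD d} (H : AgreeD (2 * mSeq s + 1) g h) :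
    g ∈ Fspi π.f s ↔ h ∈ Fspi π.f s := by
  have hbox : ∀ l, π.p s (idxD g (mSeq s)) l < 2 ^ mSeq s :=
    π.maps s (show idxD g (mSeq s) ∈ box d (mSeq s) from idxD_lt g _)
  rw [Fspi_iff, Fspi_iff, walshD_congr (fun l => Nat.pow_lt_pow_right (by norm_num)
    (Nat.lt_succ_self _)) H, ← idxD_congr (H.mono' (show mSeq s ≤ _ by omega)),
    walshD_congr hbox (shiftD_agree (H.mono' (by omega)))]

/-- flip the coordinate `(l, k)` -/
def flipD {d : ℕ} (l : Fin d) (k : ℕ) (g : GD d) : GD d :=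
  fun l' t => if l' = l ∧ t = k then g l' t + 1 else g l' t

lemma flipD_agree {d : ℕ} (l : Fin d) (k : ℕ) (g : GD d) : AgreeD k g (flipD l k g) := by
  intro l' t ht
  simp only [flipD]
  rw [if_neg]; omega

lemma walshD_flip {d : ℕ} (l : Fin d) (k : ℕ) (g : GD d) :
    walshD (fun _ => 2 ^ k) (flipD l k g) = - walshD (fun _ => 2 ^ k) g := by
  simp only [walshD, walsh_pow]
  rw [← Finset.mul_prod_erase _ _ (Finset.mem_univ l),
    ← Finset.mul_prod_erase Finset.univ (fun i => wfac true (g i k)) (Finset.mem_univ l), ← neg_mul]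
  congr 1
  · rcases zmod2_cases (g l k) with h | h
    · simp [flipD, wfac, h]
    · have : (1 : ZMod 2) + 1 = 0 := rfl
      simp [flipD, wfac, h, this]
  · refine Finset.prod_congr rfl fun i hi => ?_
    have : i ≠ l := by simpa using hi
    simp [flipD, this]

lemma Fspi_flip {d : ℕ} (π : PermSeq d) (s : ℕ) (l : Fin d) (g : GD d) :
    flipD l (2 * mSeq s) g ∈ Fspi π.f s ↔ g ∉ Fspi π.f s := by
  have H := (flipD_agree l (2 * mSeq s) g)
  have hbox : ∀ l, π.p s (idxD g (mSeq s)) l < 2 ^ mSeq s :=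
    π.maps s (show idxD g (mSeq s) ∈ box d (mSeq s) from idxD_lt g _)
  rw [Fspi_iff, Fspi_iff, walshD_flip, ← idxD_congr (H.mono' (show mSeq s ≤ _ by omega)),
    ← walshD_congr hbox (shiftD_agree (H.mono' (show mSeq s + mSeq s ≤ _ by omega)))]
  rcases walshD_cases (fun _ => 2 ^ (2 * mSeq s)) g with h | h <;>
  rcases walshD_cases (π.p s (idxD g (mSeq s))) (shiftD (mSeq s) g) with h' | h' <;>
  rw [h, h'] <;> norm_num

/-! ### The sequence -/

lemma mSeq_one : mSeq 1 = 0 := by simp [mSeq]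

lemma mSeq_succ (s : ℕ) (hs : 1 ≤ s) : mSeq (s + 1) = 4 * mSeq s + 2 := by
  rw [mSeq, if_neg (by omega)]; ring

lemma mSeq_lt {i j : ℕ} (hi : 1 ≤ i) (hij : i < j) : 4 * mSeq i + 2 ≤ mSeq j := by
  induction j, hij using Nat.le_induction with
  | base => rw [mSeq_succ i hi]
  | succ j hj ih => 
    rw [mSeq_succ j (by omega)]; omega

lemma mSeq_ge (s : ℕ) : s ≤ mSeq (s + 1) := by
  induction s with
  | zero => simp
  | succ s ih => rw [mSeq_succ _ (by omega)]; omega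

/-! ### Meeting -/

def Meets {d : ℕ} (π : PermSeq d) (k : ℕ) (g : GD d) : Prop := ∃ h ∈ Fpi π.f, AgreeD k g h

/-- successive corrections -/
def corr {d : ℕ} (π : PermSeq d) (l : Fin d) (g : GD d) : ℕ → GD d
  | 0 => g
  | j + 1 => if corr π l g j ∈ Fspi π.f (j + 1) then corr π l g j
      else flipD l (2 * mSeq (j + 1)) (corr π l g j)

lemma corr_succ_agree {d : ℕ} (π : PermSeq d) (l : Fin d) (g : GD d) (j : ℕ) :
    AgreeD (2 * mSeq (j + 1)) (corr π l g j) (corr π l g (j + 1)) := by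
  simp only [corr]
  split_ifs
  · exact fun _ _ _ => rfl
  · exact flipD_agree _ _ _

lemma corr_agree {d : ℕ} (π : PermSeq d) (l : Fin d) (g : GD d) (i j : ℕ) (hij : i ≤ j) :
    AgreeD (2 * mSeq (i + 1)) (corr π l g i) (corr π l g j) := by
  induction j, hij using Nat.le_induction with
  | base => exact fun _ _ _ => rfl
  | succ j hj ih =>
    refine ih.trans' ((corr_succ_agree π l g j).mono' ?_)
    rcases hj.eq_or_lt with rfl | h
    · rfl
    · have := mSeq_lt (i := i + 1) (j := j + 1) (by omega) (by omega)
      omega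

lemma corr_mem {d : ℕ} (π : PermSeq d) (l : Fin d) (g : GD d) (j : ℕ) :
    corr π l g (j + 1) ∈ Fspi π.f (j + 1) := by
  rw [corr]
  split_ifs with h
  · exact h
  · exact (Fspi_flip π _ l _).2 h

lemma meets_iff {d : ℕ} (hd : 2 ≤ d) (π : PermSeq d) (k : ℕ) (g : GD d) :
    Meets π k g ↔ ∀ j, 1 ≤ j → 2 * mSeq j < k → g ∈ Fspi π.f j := by
  constructor
  · rintro ⟨h, hF, ha⟩ j hj hjk
    rw [Fspi_congr π j (ha.mono' (by omega))]
    simp only [Fpi, Set.mem_iInter] at hF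
    exact hF j hj
  · intro H
    let l : Fin d := ⟨0, by omega⟩
    have hag : ∀ j, AgreeD k g (corr π l g j) := by
      intro j
      induction j with
      | zero => exact fun _ _ _ => rfl
      | succ j ih =>
        by_cases hk : 2 * mSeq (j + 1) < k
        · have : corr π l g j ∈ Fspi π.f (j + 1) := by
            rw [← Fspi_congr π (j + 1) (ih.mono' (by omega))]
            exact H _ (by omega) hk
          rw [corr, if_pos this]; exact ih
        · exact ih.trans' ((corr_succ_agree π l g j).mono' (by omega))
    refine ⟨fun i t => corr π l g (t + 1) i t, ?_, ?_⟩
    · simp only [Fpi, Set.mem_iInter]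
      intro j hj
      obtain ⟨j, rfl⟩ : ∃ i, j = i + 1 := ⟨j - 1, by simp at hj; omega⟩
      rw [Fspi_congr π (j + 1) (h := corr π l g (j + 1))]
      · exact corr_mem _ _ _ _
      · intro i t ht
        rcases le_total (t + 1) (j + 1) with hle | hle
        · refine corr_agree π l g _ _ hle i t ?_
          have := mSeq_ge (t + 1); omega
        · refine (corr_agree π l g _ _ hle i t ?_).symm
          rw [mSeq_succ _ (by omega)]; omega
    · intro i t ht
      exact hag (t + 1) i t ht

/-! ### Values of the quasimeasure -/

lemma cube_inter_nonempty {d : ℕ} (π : PermSeq d) (k : ℕ) (g : GD d) :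
    (dyadicCube k (idxD g k) ∩ Fpi π.f).Nonempty ↔ Meets π k g := by
  constructor
  · rintro ⟨h, hc, hF⟩
    exact ⟨h, hF, agree_of_idxD ((mem_cube_iff (idxD_lt g k) h).1 hc)⟩
  · rintro ⟨h, hF, ha⟩
    exact ⟨h, (mem_cube_iff (idxD_lt g k) h).2 (idxD_congr ha), hF⟩

/-- replace the coordinates of level `k` -/
def extD {d : ℕ} (g : GD d) (k : ℕ) (σ : Fin d → Fin 2) : GD d :=
  fun l t => if t = k then (σ l : ℕ) else g l t

lemma extD_agree {d : ℕ} (g : GD d) (k : ℕ) (σ : Fin d → Fin 2) : AgreeD k g (extD g k σ) := by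
  intro l t ht
  simp [extD, ht.ne]

lemma idxD_extD {d : ℕ} (g : GD d) (k : ℕ) (σ : Fin d → Fin 2) :
    idxD (extD g k σ) (k + 1) = fun l => 2 * idxD g k l + (σ l : ℕ) := by
  funext l
  have := congrFun (idxD_congr (extD_agree g k σ)) l
  simp only [idxD, idxG] at this ⊢
  rw [this]
  congr 1
  simp only [extD, if_true]
  exact ZMod.val_cast_of_lt (σ l).2

lemma exists_ext {d : ℕ} (g : GD d) (k : ℕ) : ∃ σ : Fin d → Fin 2, AgreeD (k + 1) g (extD g k σ) := by
  refine ⟨fun l => ⟨(g l k).val, ZMod.val_lt _⟩, ?_⟩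
  intro l t ht
  by_cases h : t = k
  · subst h; simp [extD]
  · simp [extD, h]

lemma Meets.mono' {d : ℕ} {π : PermSeq d} {k k' : ℕ} {g : GD d} (h : Meets π k g) (hk : k' ≤ k) :
    Meets π k' g := by
  obtain ⟨h, hF, ha⟩ := h
  exact ⟨h, hF, ha.mono' hk⟩

lemma tau_zero_of {d : ℕ} {π : PermSeq d} {τ : ℕ → (Fin d → ℕ) → ℂ} (hτ : IsTauOf (Fpi π.f) τ)
    {k : ℕ} {g : GD d} (h : ¬ Meets π k g) : τ k (idxD g k) = 0 := by
  rw [hτ.2.2.1 k _ (idxD_lt g k)]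
  rw [← cube_inter_nonempty] at h
  exact Set.not_nonempty_iff_eq_empty.1 h

lemma tau_step {d : ℕ} {π : PermSeq d} {τ : ℕ → (Fin d → ℕ) → ℂ} (hτ : IsTauOf (Fpi π.f) τ)
    {k : ℕ} {g : GD d} (h : Meets π (k + 1) g) :
    τ (k + 1) (idxD g (k + 1)) = τ k (idxD g k) /
      ((Finset.univ.filter fun σ : Fin d → Fin 2 => Meets π (k + 1) (extD g k σ)).card : ℂ) := by
  obtain ⟨σ, hσ⟩ := exists_ext g k
  have h4 := hτ.2.2.2 k (idxD g k) (idxD_lt g k)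
    ((cube_inter_nonempty π k g).2 (h.mono' (by omega))) σ
  simp only [← idxD_extD, cube_inter_nonempty] at h4
  rw [idxD_congr hσ, h4, if_pos]
  obtain ⟨h', hF, ha⟩ := h
  exact ⟨h', hF, hσ.symm'.trans' ha⟩

lemma tau_step_free {d : ℕ} (hd : 2 ≤ d) {π : PermSeq d} {τ : ℕ → (Fin d → ℕ) → ℂ}
    (hτ : IsTauOf (Fpi π.f) τ) {k : ℕ} {g : GD d} (h : Meets π (k + 1) g)
    (hk : ∀ j, 1 ≤ j → 2 * mSeq j ≠ k) :
    τ (k + 1) (idxD g (k + 1)) = τ k (idxD g k) / 2 ^ d := by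
  rw [tau_step hτ h, Finset.filter_true_of_mem]
  · simp
  · intro σ _
    rw [meets_iff hd] at h ⊢
    intro j hj hjk
    have := hk j hj
    rw [← Fspi_congr π j ((extD_agree g k σ).mono' (by omega))]
    exact h j hj hjk

lemma tau_step_half {d : ℕ} (hd : 2 ≤ d) {π : PermSeq d} {τ : ℕ → (Fin d → ℕ) → ℂ}
    (hτ : IsTauOf (Fpi π.f) τ) {s : ℕ} (hs : 1 ≤ s) {g : GD d} (h : Meets π (2 * mSeq s + 1) g) :
    τ (2 * mSeq s + 1) (idxD g (2 * mSeq s + 1)) = τ (2 * mSeq s) (idxD g (2 * mSeq s)) / 2 ^ d * 2 := by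
  rw [tau_step hτ h]
  have hm : ∀ σ, Meets π (2 * mSeq s + 1) (extD g (2 * mSeq s) σ) ↔
      extD g (2 * mSeq s) σ ∈ Fspi π.f s := by
    intro σ
    rw [meets_iff hd] at h ⊢
    constructor
    · intro H; exact H s hs (by omega)
    · intro H j hj hjk
      rcases lt_trichotomy j s with hlt | rfl | hlt
      · have := mSeq_lt hj hlt
        rw [← Fspi_congr π j ((extD_agree g (2 * mSeq s) σ).mono' (by omega))]
        exact h j hj hjk
      · exact H
      · have := mSeq_lt hs hlt
        omega
  simp only [hm]
  let l0 : Fin d := ⟨0, by omega⟩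
  have hflip : ∀ σ : Fin d → Fin 2, extD g (2 * mSeq s) (Function.update σ l0 (1 - σ l0)) =
      flipD l0 (2 * mSeq s) (extD g (2 * mSeq s) σ) := by
    intro σ
    funext l t
    by_cases ht : t = 2 * mSeq s
    · by_cases hl : l = l0
      · subst hl
        simp only [extD, flipD, ht, Function.update_self, if_true, and_self]
        generalize σ l0 = x
        revert x; decide
      · simp [extD, flipD, ht, hl]
    · simp [extD, flipD, ht]
  have hcard : (Finset.univ.filter fun σ : Fin d → Fin 2 =>
      extD g (2 * mSeq s) σ ∈ Fspi π.f s).card = (Finset.univ.filter fun σ : Fin d → Fin 2 =>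
      ¬ extD g (2 * mSeq s) σ ∈ Fspi π.f s).card := by
    have hinv : ∀ σ : Fin d → Fin 2, Function.update (Function.update σ l0 (1 - σ l0)) l0
        (1 - (Function.update σ l0 (1 - σ l0)) l0) = σ := by
      intro σ; simp
    refine Finset.card_bij' (fun σ _ => Function.update σ l0 (1 - σ l0))
      (fun σ _ => Function.update σ l0 (1 - σ l0)) ?_ ?_ ?_ ?_
    · intro σ hσ
      simp only [Finset.mem_filter, Finset.mem_univ, true_and] at hσ ⊢
      rw [hflip, Fspi_flip]; simpa using hσ
    · intro σ hσ
      simp only [Finset.mem_filter, Finset.mem_univ, true_and] at hσ ⊢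
      rw [hflip, Fspi_flip]; simpa using hσ
    · intro σ _; exact hinv σ
    · intro σ _; exact hinv σ
  have htot := Finset.card_filter_add_card_filter_not (s := (Finset.univ : Finset (Fin d → Fin 2)))
    (fun σ : Fin d → Fin 2 => extD g (2 * mSeq s) σ ∈ Fspi π.f s)
  rw [← hcard] at htot
  set c := (Finset.univ.filter fun σ : Fin d → Fin 2 =>
      extD g (2 * mSeq s) σ ∈ Fspi π.f s).card
  have hc : (2 : ℂ) ^ d = c * 2 := by
    have : c + c = 2 ^ d := by rw [htot]; simp
    have := congrArg (Nat.cast (R := ℂ)) this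
    push_cast at this
    rw [← this]; ring
  rw [hc, div_mul_eq_mul_div, mul_div_mul_right _ _ two_ne_zero]

lemma tau_run {d : ℕ} (hd : 2 ≤ d) {π : PermSeq d} {τ : ℕ → (Fin d → ℕ) → ℂ}
    (hτ : IsTauOf (Fpi π.f) τ) (a b : ℕ) {g : GD d} (h : Meets π (a + b) g)
    (hk : ∀ j, 1 ≤ j → 2 * mSeq j < a ∨ a + b ≤ 2 * mSeq j) :
    τ (a + b) (idxD g (a + b)) = τ a (idxD g a) / 2 ^ (d * b) := by
  induction b with
  | zero => simp
  | succ b ih =>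
    rw [← add_assoc] at h ⊢
    rw [tau_step_free hd hτ h, ih (h.mono' (by omega)), div_div, ← pow_add, mul_add, mul_one]
    · intro j hj
      have := hk j hj
      omega
    · intro j hj
      have := hk j hj
      omega

lemma tau_double {d : ℕ} (hd : 2 ≤ d) {π : PermSeq d} {τ : ℕ → (Fin d → ℕ) → ℂ}
    (hτ : IsTauOf (Fpi π.f) τ) {s : ℕ} (hs : 1 ≤ s) {g : GD d} (h : Meets π (mSeq s) g) :
    τ (mSeq s + mSeq s) (idxD g (mSeq s + mSeq s)) =
      τ (mSeq s) (idxD g (mSeq s)) / 2 ^ (d * mSeq s) := by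
  have key : ∀ j, 1 ≤ j → 2 * mSeq j < mSeq s ∨ mSeq s + mSeq s ≤ 2 * mSeq j := by
    intro j hj
    rcases lt_trichotomy j s with hlt | rfl | hlt
    · have := mSeq_lt hj hlt; omega
    · omega
    · have := mSeq_lt hs hlt; omega
  apply tau_run hd hτ _ _ _ key
  rw [meets_iff hd] at h ⊢
  intro j hj hjk
  refine h j hj ?_
  have := key j hj
  omega

lemma tau_val {d : ℕ} (hd : 2 ≤ d) {π : PermSeq d} {τ : ℕ → (Fin d → ℕ) → ℂ}
    (hτ : IsTauOf (Fpi π.f) τ) (s : ℕ) {g : GD d} (h : Meets π (mSeq (s + 1)) g) :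
    τ (mSeq (s + 1)) (idxD g (mSeq (s + 1))) = 2 ^ s / 2 ^ (d * mSeq (s + 1)) := by
  induction s with
  | zero =>
    simp only [zero_add, mSeq_one]
    have h0 : idxD g 0 = fun _ => 0 := rfl
    rw [h0]
    simpa using hτ.2.1
  | succ s ih =>
    have e := mSeq_succ (s + 1) (by omega)
    have e' : mSeq (s + 1 + 1) = (2 * mSeq (s + 1) + 1) + (2 * mSeq (s + 1) + 1) := by omega
    rw [e'] at h ⊢
    have h1 : Meets π (2 * mSeq (s + 1) + 1) g := h.mono' (by omega)
    rw [tau_run hd hτ _ _ h, tau_step_half hd hτ (by omega) h1]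
    · have h2 : Meets π (mSeq (s + 1)) g := h.mono' (by omega)
      have := tau_double hd hτ (by omega) h2
      rw [← two_mul] at this
      rw [this, ih h2]
      have e2 : (2 : ℂ) ^ (d * (2 * mSeq (s + 1) + 1 + (2 * mSeq (s + 1) + 1))) =
        2 ^ (d * mSeq (s + 1)) * 2 ^ (d * mSeq (s + 1)) * 2 ^ d * 2 ^ (d * (2 * mSeq (s + 1) + 1)) := by
        simp only [← pow_add]; congr 1; ring
      rw [e2, pow_succ]
      field_simp
    · intro j hj
      rcases lt_trichotomy j (s + 1) with hlt | rfl | hlt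
      · have := mSeq_lt hj hlt; omega
      · omega
      · rcases Nat.lt_or_ge (s + 1 + 1) j with h' | h'
        · have := mSeq_lt (by omega) h'; omega
        · have : j = s + 1 + 1 := by omega
          subst this; omega

/-! ### Sums over boxes -/

lemma mem_boxLt {d k : ℕ} {m : Fin d → ℕ} :
    m ∈ boxLt (fun _ : Fin d => 2 ^ k) ↔ ∀ l, m l < 2 ^ k := by
  simp [boxLt]

lemma sum_box_add {d : ℕ} (a b : ℕ) (f : (Fin d → ℕ) → ℂ) :
    ∑ m ∈ boxLt (fun _ : Fin d => 2 ^ (a + b)), f m =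
      ∑ m ∈ boxLt (fun _ : Fin d => 2 ^ a), ∑ m' ∈ boxLt (fun _ : Fin d => 2 ^ b),
        f (fun l => 2 ^ b * m l + m' l) := by
  rw [← Finset.sum_product']
  symm
  refine Finset.sum_bij (fun x _ => fun l => 2 ^ b * x.1 l + x.2 l) ?_ ?_ ?_ ?_
  · intro x hx
    rw [Finset.mem_product, mem_boxLt, mem_boxLt] at hx
    rw [mem_boxLt]
    exact box_lt_add hx.1 hx.2
  · intro x hx y hy hxy
    rw [Finset.mem_product, mem_boxLt, mem_boxLt] at hx hy
    have := fun l => divmod_unique (hx.2 l) (hy.2 l) (congrFun hxy l)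
    exact Prod.ext (funext fun l => (this l).1) (funext fun l => (this l).2)
  · intro m hm
    rw [mem_boxLt] at hm
    refine ⟨(fun l => m l / 2 ^ b, fun l => m l % 2 ^ b), ?_, ?_⟩
    · rw [Finset.mem_product, mem_boxLt, mem_boxLt]
      refine ⟨fun l => ?_, fun l => Nat.mod_lt _ (by positivity)⟩
      apply Nat.div_lt_of_lt_mul
      rw [← pow_add, add_comm]; exact hm l
    · funext l
      exact Nat.div_add_mod _ _
  · intro x _; rfl

lemma sum_box_one {d : ℕ} (f : (Fin d → ℕ) → ℂ) :
    ∑ m ∈ boxLt (fun _ : Fin d => 2 ^ 1), f m = ∑ σ : Fin d → Fin 2, f (fun l => (σ l : ℕ)) := by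
  symm
  refine Finset.sum_bij (fun σ _ => fun l => (σ l : ℕ)) ?_ ?_ ?_ ?_
  · intro σ _
    rw [mem_boxLt]; intro l; exact (σ l).2
  · intro σ _ σ' _ h
    funext l
    exact Fin.ext (congrFun h l)
  · intro m hm
    rw [mem_boxLt] at hm
    exact ⟨fun l => ⟨m l, hm l⟩, Finset.mem_univ _, rfl⟩
  · intro _ _; rfl

lemma qm_sum {d : ℕ} {τ : ℕ → (Fin d → ℕ) → ℂ} (hτ : IsQuasimeasure τ) (a b : ℕ) (m : Fin d → ℕ)
    (hm : ∀ l, m l < 2 ^ a) :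
    ∑ m' ∈ boxLt (fun _ : Fin d => 2 ^ b), τ (a + b) (fun l => 2 ^ b * m l + m' l) = τ a m := by
  induction b with
  | zero =>
    rw [Finset.sum_eq_single (fun _ => 0)]
    · simp
    · intro m' hm' hne
      rw [mem_boxLt] at hm'
      exact absurd (funext fun l => by have := hm' l; simpa using this) hne
    · intro h
      exact absurd (mem_boxLt.2 fun l => by simp) h
  | succ b ih =>
    rw [sum_box_add, ← ih]
    refine Finset.sum_congr rfl fun m' hm' => ?_
    rw [mem_boxLt] at hm'
    rw [sum_box_one, hτ _ _ (box_lt_add hm hm')]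
    refine Finset.sum_congr rfl fun σ _ => ?_
    rw [← add_assoc]
    congr 1
    funext l
    ring

/-- refinement of the local coefficient sums -/
def locSum {d : ℕ} (τ : ℕ → (Fin d → ℕ) → ℂ) (n : Fin d → ℕ) (r : ℕ) (m : Fin d → ℕ) (b : ℕ) : ℂ :=
  ∑ m' ∈ boxLt (fun _ : Fin d => 2 ^ b),
    (walshValD (r + b) n (fun l => 2 ^ b * m l + m' l) : ℂ) * τ (r + b) (fun l => 2 ^ b * m l + m' l)

lemma walshValD_refine {d : ℕ} (a b : ℕ) (n m m' : Fin d → ℕ) (hn : ∀ l, n l < 2 ^ a)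
    (hm : ∀ l, m l < 2 ^ a) (hm' : ∀ l, m' l < 2 ^ b) :
    walshValD (a + b) n (fun l => 2 ^ b * m l + m' l) = walshValD a n m := by
  set g : GD d := cubePoint (a + b) (fun l => 2 ^ b * m l + m' l) with hg
  have h1 : idxD g (a + b) = fun l => 2 ^ b * m l + m' l := idxD_point (box_lt_add hm hm')
  have h2 : idxD g a = m := by
    rw [idxD_add] at h1
    exact funext fun l => (divmod_unique (idxD_lt _ _ l) (hm' l) (congrFun h1 l)).1
  have h3 := walshValD_eq a n hn g
  rw [h2] at h3
  exact h3.symm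

lemma local_eq_locSum {d : ℕ} (τ : ℕ → (Fin d → ℕ) → ℂ) (n : Fin d → ℕ) (r : ℕ) (m : Fin d → ℕ)
    (hm : ∀ l, m l < 2 ^ r) (b : ℕ) : localCoeffAt τ n r m (r + b) = locSum τ n r m b := by
  unfold localCoeffAt locSum
  symm
  refine Finset.sum_bij (fun m' _ => fun l => 2 ^ b * m l + m' l) ?_ ?_ ?_ ?_
  · intro m' hm'
    rw [mem_boxLt] at hm'
    rw [Finset.mem_filter, mem_boxLt]
    refine ⟨box_lt_add hm hm', ?_⟩
    intro g hg
    rw [mem_cube_iff (box_lt_add hm hm'), idxD_add] at hg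
    rw [mem_cube_iff hm]
    exact funext fun l => (divmod_unique (hm' l) (idxD_lt _ _ l) (congrFun hg l)).1
  · intro x hx y hy hxy
    rw [mem_boxLt] at hx hy
    exact funext fun l => (divmod_unique (hx l) (hy l) (congrFun hxy l)).2
  · intro M hM
    rw [Finset.mem_filter, mem_boxLt] at hM
    obtain ⟨hM, hsub⟩ := hM
    have h1 : idxD (cubePoint (r + b) M) (r + b) = M := idxD_point hM
    have h2 : cubePoint (r + b) M ∈ dyadicCube r m := hsub ((mem_cube_iff hM _).2 h1.symm)
    rw [mem_cube_iff hm] at h2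
    refine ⟨idxD (shiftD r (cubePoint (r + b) M)) b, mem_boxLt.2 (idxD_lt _ _), ?_⟩
    rw [idxD_add, ← h2] at h1
    exact h1
  · intro _ _; rfl

lemma locSum_add {d : ℕ} {τ : ℕ → (Fin d → ℕ) → ℂ} (hτ : IsQuasimeasure τ) (n : Fin d → ℕ) (r : ℕ)
    (m : Fin d → ℕ) (hm : ∀ l, m l < 2 ^ r) (b e : ℕ) (hn : ∀ l, n l < 2 ^ (r + b)) :
    locSum τ n r m (b + e) = locSum τ n r m b := by
  unfold locSum
  rw [sum_box_add]
  refine Finset.sum_congr rfl fun m' hm' => ?_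
  rw [mem_boxLt] at hm'
  rw [← qm_sum hτ (r + b) e _ (box_lt_add hm hm'), Finset.mul_sum]
  refine Finset.sum_congr rfl fun x hx => ?_
  rw [mem_boxLt] at hx
  rw [← walshValD_refine (r + b) e n _ x hn (box_lt_add hm hm') hx]
  have : (fun l => 2 ^ (b + e) * m l + (2 ^ e * m' l + x l)) =
      fun l => 2 ^ e * (2 ^ b * m l + m' l) + x l := by
    funext l; rw [pow_add]; ring
  rw [this, add_assoc]

/-! ### Main computation -/

lemma main_inner {d : ℕ} {π : PermSeq d} {τ : ℕ → (Fin d → ℕ) → ℂ}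
    (hτ : IsTauOf (Fpi π.f) τ) {s : ℕ} (hs : 1 ≤ s)
    (p q : Fin d → ℕ) (hp : ∀ l, p l < 2 ^ mSeq s) (hq : ∀ l, q l < 2 ^ mSeq s)
    (hn : ∀ l, 2 ^ (2 * mSeq s) + 2 ^ mSeq s * p l + q l < 2 ^ (mSeq s + mSeq s + 1))
    (m m' : Fin d → ℕ) (hm : ∀ l, m l < 2 ^ mSeq s) (hm' : ∀ l, m' l < 2 ^ mSeq s)
    (x : Fin d → ℕ) (hx : ∀ l, x l < 2 ^ 1) :
    (walshValD (mSeq s + mSeq s + 1) (fun l => 2 ^ (2 * mSeq s) + 2 ^ mSeq s * p l + q l)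
        (fun l => 2 ^ 1 * (2 ^ mSeq s * m l + m' l) + x l) : ℂ) *
      τ (mSeq s + mSeq s + 1) (fun l => 2 ^ 1 * (2 ^ mSeq s * m l + m' l) + x l) =
    (walshValD (mSeq s) q m * (walshValD (mSeq s) (π.p s m) m' * walshValD (mSeq s) p m') : ℝ) *
      τ (mSeq s + mSeq s + 1) (fun l => 2 ^ 1 * (2 ^ mSeq s * m l + m' l) + x l) := by
  have hlt := box_lt_add (box_lt_add hm hm') hx
  set M : Fin d → ℕ := fun l => 2 ^ 1 * (2 ^ mSeq s * m l + m' l) + x l with hM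
  by_cases hmeet : τ (mSeq s + mSeq s + 1) M = 0
  · rw [hmeet, mul_zero, mul_zero]
  congr 2
  have hne := mt (hτ.2.2.1 _ M hlt).2 hmeet
  obtain ⟨g, hg, hF⟩ := Set.nonempty_iff_ne_empty.2 hne
  rw [mem_cube_iff hlt] at hg
  have h1 : (fun l => 2 ^ mSeq s * m l + m' l) = idxD g (mSeq s + mSeq s) := by
    rw [idxD_add] at hg
    exact funext fun l => (divmod_unique (hx l) (idxD_lt _ _ l) (congrFun hg l)).1
  have h2 : m = idxD g (mSeq s) ∧ m' = idxD (shiftD (mSeq s) g) (mSeq s) := by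
    rw [idxD_add] at h1
    have := fun l => divmod_unique (hm' l) (idxD_lt _ _ l) (congrFun h1 l)
    exact ⟨funext fun l => (this l).1, funext fun l => (this l).2⟩
  have hgF : g ∈ Fspi π.f s := by
    simp only [Fpi, Set.mem_iInter] at hF
    exact hF s hs
  rw [Fspi_iff, ← h2.1] at hgF
  have hbox : ∀ l, π.p s m l < 2 ^ mSeq s := π.maps s (show m ∈ box d (mSeq s) from hm)
  have hg' : M = idxD g (mSeq s + mSeq s + 1) := hg
  rw [hg', walshValD_eq _ _ hn, h2.2, walshValD_eq _ _ hp, walshValD_eq _ _ hbox, ← hgF]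
  conv_rhs => rw [h2.1, walshValD_eq _ _ hq]
  have e1 : (fun l => 2 ^ (2 * mSeq s) + 2 ^ mSeq s * p l + q l) =
      fun l => 2 ^ mSeq s * (2 ^ mSeq s * 1 + p l) + q l := by
    funext l; rw [two_mul, pow_add]; ring
  have e2 : (fun _ : Fin d => 2 ^ (2 * mSeq s)) =
      fun l => 2 ^ mSeq s * (2 ^ mSeq s * 1 + 0) + 0 := by
    funext l; rw [two_mul, pow_add]; ring
  have hz : ∀ l : Fin d, 0 < 2 ^ mSeq s := fun l => by positivity
  rw [e1, e2, walshD_split _ (fun l => 2 ^ mSeq s * 1 + p l) _ hq,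
    walshD_split _ (fun _ => 1) _ hp, walshD_split _ (fun l => 2 ^ mSeq s * 1 + 0) (fun _ => 0) hz,
    walshD_split _ (fun _ => 1) (fun _ => 0) hz]
  have hw0 : ∀ h : GD d, walshD (fun _ => 0) h = 1 := fun h => by simp [walshD, walsh]
  rw [hw0, hw0]
  ring

lemma nbound {a p q : ℕ} (hp : p < 2 ^ a) (hq : q < 2 ^ a) :
    2 ^ (2 * a) + 2 ^ a * p + q < 2 ^ (a + a + 1) := by
  rw [two_mul, pow_succ, pow_add]
  nlinarith

lemma main_loc {d : ℕ} (hd : 2 ≤ d) {π : PermSeq d} {τ : ℕ → (Fin d → ℕ) → ℂ}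
    (hτ : IsTauOf (Fpi π.f) τ) {s : ℕ} (hs : 1 ≤ s)
    (p q : Fin d → ℕ) (hp : ∀ l, p l < 2 ^ mSeq s) (hq : ∀ l, q l < 2 ^ mSeq s)
    (m : Fin d → ℕ) (hm : ∀ l, m l < 2 ^ mSeq s) :
    locSum τ (fun l => 2 ^ (2 * mSeq s) + 2 ^ mSeq s * p l + q l) (mSeq s) m (mSeq s + 1) =
      if π.p s m = p then (walshValD (mSeq s) q m : ℂ) * τ (mSeq s) m else 0 := by
  have hn := fun l => nbound (hp l) (hq l)
  have hbox : ∀ l, π.p s m l < 2 ^ mSeq s := π.maps s (show m ∈ box d (mSeq s) from hm)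
  have hdouble : ∀ m' : Fin d → ℕ, (∀ l, m' l < 2 ^ mSeq s) →
      τ (mSeq s + mSeq s) (fun l => 2 ^ mSeq s * m l + m' l) = τ (mSeq s) m / 2 ^ (d * mSeq s) := by
    intro m' hm'
    set g := cubePoint (mSeq s + mSeq s) (fun l => 2 ^ mSeq s * m l + m' l)
    have h1 : idxD g (mSeq s + mSeq s) = fun l => 2 ^ mSeq s * m l + m' l :=
      idxD_point (box_lt_add hm hm')
    have h2 : idxD g (mSeq s) = m := by
      rw [idxD_add] at h1
      exact funext fun l => (divmod_unique (idxD_lt _ _ l) (hm' l) (congrFun h1 l)).1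
    rw [← h1, ← h2]
    by_cases h : Meets π (mSeq s) g
    · exact tau_double hd hτ hs h
    · rw [tau_zero_of hτ h, tau_zero_of hτ (fun h' => h (h'.mono' (by omega))), zero_div]
  unfold locSum
  rw [sum_box_add]
  have step : ∀ m' ∈ boxLt (fun _ : Fin d => 2 ^ mSeq s),
      ∑ x ∈ boxLt (fun _ : Fin d => 2 ^ 1),
        (walshValD (mSeq s + (mSeq s + 1)) (fun l => 2 ^ (2 * mSeq s) + 2 ^ mSeq s * p l + q l)
          (fun l => 2 ^ (mSeq s + 1) * m l + (2 ^ 1 * m' l + x l)) : ℂ) *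
        τ (mSeq s + (mSeq s + 1)) (fun l => 2 ^ (mSeq s + 1) * m l + (2 ^ 1 * m' l + x l)) =
      ((walshValD (mSeq s) (π.p s m) m' * walshValD (mSeq s) p m' : ℝ) : ℂ) *
        (walshValD (mSeq s) q m * τ (mSeq s) m / 2 ^ (d * mSeq s)) := by
    intro m' hm'
    rw [mem_boxLt] at hm'
    have : ∀ x : Fin d → ℕ, (fun l => 2 ^ (mSeq s + 1) * m l + (2 ^ 1 * m' l + x l)) =
        fun l => 2 ^ 1 * (2 ^ mSeq s * m l + m' l) + x l := by
      intro x; funext l; ring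
    simp only [this]
    rw [← add_assoc]
    rw [Finset.sum_congr rfl fun x hx => main_inner hτ hs p q hp hq hn m m' hm hm' x
      (mem_boxLt.1 hx), ← Finset.mul_sum, qm_sum hτ.1 _ _ _ (box_lt_add hm hm'), hdouble m' hm']
    push_cast; ring
  rw [Finset.sum_congr rfl step, ← Finset.sum_mul, ← Complex.ofReal_sum,
    walshD_orth _ _ _ hbox hp]
  split_ifs with h
  · push_cast; field_simp
  · simp

lemma meets_iff_Ftil {d : ℕ} (hd : 2 ≤ d) (π : PermSeq d) {s : ℕ} (hs : 1 ≤ s) (g : GD d) :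
    Meets π (mSeq s) g ↔ dyadicCube (mSeq s) (idxD g (mSeq s)) ⊆ Ftil π.f (s - 1) := by
  rw [meets_iff hd]
  constructor
  · intro H h hh
    rw [mem_cube_iff (idxD_lt _ _)] at hh
    simp only [Ftil, Set.mem_iInter, Finset.mem_Icc]
    intro j hj
    have := mSeq_lt hj.1 (show j < s by omega)
    rw [← Fspi_congr π j ((agree_of_idxD hh).mono' (by omega))]
    exact H j hj.1 (by omega)
  · intro H j hj hjs
    have h1 := H ((mem_cube_iff (idxD_lt _ _) g).2 rfl)
    simp only [Ftil, Set.mem_iInter, Finset.mem_Icc] at h1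
    refine h1 j ⟨hj, ?_⟩
    by_contra hc
    rcases (show s = j ∨ s < j by omega) with rfl | hlt
    · omega
    · have := mSeq_lt hs hlt; omega

lemma tau_final {d : ℕ} (hd : 2 ≤ d) {π : PermSeq d} {τ : ℕ → (Fin d → ℕ) → ℂ}
    (hτ : IsTauOf (Fpi π.f) τ) {s : ℕ} (hs : 1 ≤ s) (m : Fin d → ℕ) (hm : ∀ l, m l < 2 ^ mSeq s) :
    τ (mSeq s) m = if dyadicCube (mSeq s) m ⊆ Ftil π.f (s - 1) then
      (2 : ℂ) ^ (s - 1) / (2 : ℂ) ^ (d * mSeq s) else 0 := by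
  have h1 := idxD_point hm
  rw [← h1, ← meets_iff_Ftil hd π hs]
  split_ifs with h
  · obtain ⟨s, rfl⟩ : ∃ i, s = i + 1 := ⟨s - 1, by omega⟩
    exact tau_val hd hτ s h
  · exact tau_zero_of hτ h

lemma symm_mem_box {d : ℕ} (π : PermSeq d) (s : ℕ) {p : Fin d → ℕ} (hp : ∀ l, p l < 2 ^ mSeq s) :
    ∀ l, (π.p s).symm p l < 2 ^ mSeq s := by
  have hs : Set.SurjOn (π.p s) (boxLt (fun _ : Fin d => 2 ^ mSeq s) : Set (Fin d → ℕ))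
      (boxLt (fun _ : Fin d => 2 ^ mSeq s)) := by
    apply Finset.surjOn_of_injOn_of_card_le
    · intro m hm
      rw [Finset.mem_coe, mem_boxLt] at hm ⊢
      exact π.maps s hm
    · exact (π.p s).injective.injOn
    · rfl
  obtain ⟨m, hm, rfl⟩ := hs (Finset.mem_coe.2 (mem_boxLt.2 hp))
  rw [Equiv.symm_apply_apply]
  exact mem_boxLt.1 hm

/-- local and global Fourier–Walsh coefficients of `τ^π = τ_{F^π}` at
indices `𝐧 = 2^{2m_s}𝟏 + 2^{m_s}𝐩 + 𝐪`. -/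
theorem statement10 (d : ℕ) (hd : 2 ≤ d) (π : PermSeq d)
    (τ : ℕ → (Fin d → ℕ) → ℂ) (hτ : IsTauOf (Fpi π.f) τ) (s : ℕ) (hs : 1 ≤ s)
    (p q : Fin d → ℕ) (hp : ∀ l, p l < 2 ^ mSeq s) (hq : ∀ l, q l < 2 ^ mSeq s)
    (n : Fin d → ℕ) (hn : n = fun l => 2 ^ (2 * mSeq s) + 2 ^ mSeq s * p l + q l) :
    (∀ m : Fin d → ℕ, (∀ l, m l < 2 ^ mSeq s) →
      ∀ k : ℕ, (∀ l, n l < 2 ^ k) → mSeq s ≤ k →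
        localCoeffAt τ n (mSeq s) m k =
          if π.p s m = p ∧ dyadicCube (mSeq s) m ⊆ Ftil π.f (s - 1) then
            (2 : ℂ) ^ (s - 1) / (2 : ℂ) ^ (d * mSeq s) * (walshValD (mSeq s) q m : ℂ)
          else 0) ∧
    (∀ k : ℕ, (∀ l, n l < 2 ^ k) →
      fourierCoeffAt τ n k =
        if dyadicCube (mSeq s) ((π.p s).symm p) ⊆ Ftil π.f (s - 1) then
          (2 : ℂ) ^ (s - 1) / (2 : ℂ) ^ (d * mSeq s) *
            (walshValD (mSeq s) q ((π.p s).symm p) : ℂ)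
        else 0) := by
  have hloc : ∀ m : Fin d → ℕ, (∀ l, m l < 2 ^ mSeq s) →
      ∀ k : ℕ, (∀ l, n l < 2 ^ k) →
        mSeq s ≤ k ∧ localCoeffAt τ n (mSeq s) m k =
          if π.p s m = p ∧ dyadicCube (mSeq s) m ⊆ Ftil π.f (s - 1) then
            (2 : ℂ) ^ (s - 1) / (2 : ℂ) ^ (d * mSeq s) * (walshValD (mSeq s) q m : ℂ)
          else 0 := by
    intro m hm k hk
    have hk2 : 2 * mSeq s < k := by
      have h0 := hk ⟨0, by omega⟩
      rw [hn] at h0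
      refine (Nat.pow_lt_pow_iff_right (show 1 < 2 by norm_num)).1 (lt_of_le_of_lt ?_ h0)
      beta_reduce
      rw [add_assoc]
      exact Nat.le_add_right _ _
    obtain ⟨e, rfl⟩ : ∃ e, k = mSeq s + (mSeq s + 1 + e) := ⟨k - (2 * mSeq s + 1), by omega⟩
    refine ⟨by omega, ?_⟩
    rw [local_eq_locSum _ _ _ _ hm, locSum_add hτ.1 _ _ _ hm, hn, main_loc hd hτ hs p q hp hq m hm,
      tau_final hd hτ hs m hm]
    · by_cases h1 : π.p s m = p <;> by_cases h2 : dyadicCube (mSeq s) m ⊆ Ftil π.f (s - 1) <;>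
        simp [h1, h2, mul_comm]
    · intro l
      rw [hn]
      exact nbound (hp l) (hq l)
  refine ⟨fun m hm k hk _ => (hloc m hm k hk).2, fun k hk => ?_⟩
  have hle : mSeq s ≤ k := (hloc p hp k hk).1
  have hsum : fourierCoeffAt τ n k =
      ∑ m ∈ boxLt (fun _ : Fin d => 2 ^ mSeq s), localCoeffAt τ n (mSeq s) m k := by
    obtain ⟨b, rfl⟩ : ∃ b, k = mSeq s + b := ⟨k - mSeq s, by omega⟩
    unfold fourierCoeffAt
    rw [sum_box_add]
    refine Finset.sum_congr rfl fun m hm => ?_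
    rw [local_eq_locSum _ _ _ _ (mem_boxLt.1 hm)]
    rfl
  have hp' := symm_mem_box π s hp
  rw [hsum, Finset.sum_eq_single ((π.p s).symm p)]
  · rw [(hloc _ hp' k hk).2]
    simp
  · intro m hm hne
    rw [(hloc m (mem_boxLt.1 hm) k hk).2, if_neg]
    rintro ⟨h, _⟩
    exact hne (by rw [← h, Equiv.symm_apply_apply])
  · intro h
    exact absurd (mem_boxLt.2 hp') h
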